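/- arXiv:2411.06533 — 2 statements merged into one kernel-verified Lean document; each statement's English description precedes it below -/
import Mathlib

section
/- Let 𝔠 > 0, γ > 0, and let a ≥ 0, b ≥ 0, ς ∈ ℝ satisfy 0 < b + |ς| < 1/2 and 3|ς| + a + 2b < 2; set η := 1 − (3|ς| + a + 2b)/2 ∈ (0,1]. Define for p, q ∈ ℝ³ with p ≠ q the kernel k̄(p,q) := (𝔠+|q|)^{(3|ς|+a+2b)/2} · e^{−γ|p−q|} / ( (|p×q|² + 𝔠²|p−q|²)^{1/2} · |p−q|^{b+|ς|} ). Then for every α > 0 there exists a constant C > 0 such that for all q ∈ ℝ³: ∫_{ℝ³} k̄(p,q) · (𝔠²+|p|²)^{α/2} dp ≤ C · (𝔠²+|q|²)^{(α−η)/2}. -/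
open MeasureTheory

/-- The Euclidean norm on ℝ³. -/
noncomputable def norm3 (p : Fin 3 → ℝ) : ℝ := Real.sqrt (p 0 ^ 2 + p 1 ^ 2 + p 2 ^ 2)

/-- The cross product on ℝ³. -/
def cross3 (p q : Fin 3 → ℝ) : Fin 3 → ℝ :=
  ![p 1 * q 2 - p 2 * q 1, p 2 * q 0 - p 0 * q 2, p 0 * q 1 - p 1 * q 0]

/-- The kernel upper bound
k̄(p,q) = (c+|q|)^{(3|ς|+a+2b)/2} e^{−γ|p−q|} / ((|p×q|²+c²|p−q|²)^{1/2}|p−q|^{b+|ς|}). -/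
noncomputable def kbar (c γ a b ς : ℝ) (p q : Fin 3 → ℝ) : ℝ :=
  (c + norm3 q) ^ ((3 * |ς| + a + 2 * b) / 2) * Real.exp (-γ * norm3 (p - q)) /
    ((norm3 (cross3 p q) ^ 2 + c ^ 2 * norm3 (p - q) ^ 2) ^ ((1 : ℝ) / 2) *
      norm3 (p - q) ^ (b + |ς|))

/-- The weight `e^{-δ|x|} |x|^{-s}` on the line, with value `∞` at the singularity. -/
noncomputable def expRpow (δ s x : ℝ) : ENNReal :=
  if x = 0 then ⊤ else ENNReal.ofReal (Real.exp (-δ * |x|) * |x| ^ (-s))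

lemma measurable_expRpow (δ s : ℝ) : Measurable (expRpow δ s) := by
  unfold expRpow
  exact Measurable.ite (measurableSet_singleton 0) measurable_const (by fun_prop)

lemma expRpow_ne_zero (δ s x : ℝ) : expRpow δ s x ≠ 0 := by
  unfold expRpow
  split_ifs with h
  · simp
  · have := abs_pos.2 h
    simp only [ne_eq, ENNReal.ofReal_eq_zero, not_le]
    positivity

lemma lintegral_expRpow_lt_top {δ s : ℝ} (hδ : 0 < δ) (hs : s < 1) :
    ∫⁻ x, expRpow δ s x < ⊤ := by
  have key : IntegrableOn (fun x : ℝ => Real.exp (-δ * |x|) * |x| ^ (-s)) (Set.Ioi 0) := by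
    refine (integrableOn_rpow_mul_exp_neg_mul_rpow (s := -s) (p := 1) (b := δ)
      (by linarith) one_pos hδ).congr_fun ?_ measurableSet_Ioi
    intro x hx
    simp only [Set.mem_Ioi] at hx
    simp only [Real.rpow_one, abs_of_pos hx, mul_comm]
  have hIci : IntegrableOn (fun x : ℝ => Real.exp (-δ * |x|) * |x| ^ (-s)) (Set.Ici 0) :=
    integrableOn_Ici_iff_integrableOn_Ioi (by simp) |>.2 key
  have key' : IntegrableOn (fun x : ℝ => Real.exp (-δ * |x|) * |x| ^ (-s)) (Set.Iio 0) := by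
    have h := hIci.comp_neg
    simp only [abs_neg] at h
    exact h.mono_set (by intro x hx; simpa using (le_of_lt hx : x ≤ 0))
  have hint : Integrable (fun x : ℝ => Real.exp (-δ * |x|) * |x| ^ (-s)) := by
    rw [← integrableOn_univ, ← Set.Iio_union_Ici (a := (0 : ℝ)), integrableOn_union]
    exact ⟨key', hIci⟩
  have hae : expRpow δ s =ᵐ[volume]
      fun x => ENNReal.ofReal (Real.exp (-δ * |x|) * |x| ^ (-s)) := by
    filter_upwards [Measure.ae_ne volume (0 : ℝ)] with x hx
    simp [expRpow, hx]
  rw [lintegral_congr_ae hae]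
  exact hint.lintegral_lt_top

/-- A product of one-variable functions composed with a shear along the `i`-th coordinate. -/
lemma lintegral_shear {f g : ℝ → ENNReal} (hf : Measurable f) (hg : Measurable g)
    (i : Fin 3) (t : Fin 2 → ℝ) :
    ∫⁻ u : Fin 3 → ℝ, f (u i) * (g (u (i.succAbove 0) - t 0 * u i) *
        g (u (i.succAbove 1) - t 1 * u i)) =
      (∫⁻ x, f x) * ((∫⁻ x, g x) * ∫⁻ x, g x) := by
  have h1 := (volume_preserving_piFinSuccAbove (fun _ : Fin 3 => ℝ) i).lintegral_comp
    (f := fun z : ℝ × (Fin 2 → ℝ) => f z.1 * (g (z.2 0 - t 0 * z.1) * g (z.2 1 - t 1 * z.1)))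
    (by fun_prop)
  have h2 : ∫⁻ y : Fin 2 → ℝ, g (y 0) * g (y 1) = (∫⁻ x, g x) * ∫⁻ x, g x := by
    have h := (volume_preserving_finTwoArrow ℝ).lintegral_comp
      (f := fun z : ℝ × ℝ => g z.1 * g z.2) (by fun_prop)
    rw [Measure.volume_eq_prod, lintegral_prod_mul hg.aemeasurable hg.aemeasurable] at h
    exact h
  have h3 (x : ℝ) : ∫⁻ y : Fin 2 → ℝ, f x * (g (y 0 - t 0 * x) * g (y 1 - t 1 * x)) =
      f x * ((∫⁻ x, g x) * ∫⁻ x, g x) := by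
    rw [lintegral_const_mul _ (by fun_prop), ← h2]
    congr 1
    exact lintegral_sub_right_eq_self (fun y : Fin 2 → ℝ => g (y 0) * g (y 1))
      (fun j => t j * x)
  rw [Measure.volume_eq_prod, lintegral_prod _ (by fun_prop)] at h1
  simp only [h3] at h1
  rw [lintegral_mul_const _ hf] at h1
  exact h1

lemma norm3_nonneg (p : Fin 3 → ℝ) : 0 ≤ norm3 p := Real.sqrt_nonneg _

lemma norm3_sq (p : Fin 3 → ℝ) : norm3 p ^ 2 = p 0 ^ 2 + p 1 ^ 2 + p 2 ^ 2 :=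
  Real.sq_sqrt (by positivity)

lemma norm3_sq_le_two_mul_add (p q : Fin 3 → ℝ) :
    norm3 p ^ 2 ≤ 2 * norm3 q ^ 2 + 2 * norm3 (p - q) ^ 2 := by
  simp only [norm3_sq, Pi.sub_apply]
  nlinarith [sq_nonneg (p 0 - 2 * q 0), sq_nonneg (p 1 - 2 * q 1), sq_nonneg (p 2 - 2 * q 2)]

lemma exists_forall_sq_le (q : Fin 3 → ℝ) : ∃ i, ∀ j, q j ^ 2 ≤ q i ^ 2 := by
  obtain ⟨i, -, hi⟩ := Finset.exists_max_image Finset.univ (fun j => q j ^ 2) ⟨0, by simp⟩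
  exact ⟨i, fun j => hi j (Finset.mem_univ j)⟩

/-- Shearing along the largest coordinate of `q` straightens the axis `ℝ q`, and the distance
to the axis is controlled by the sheared coordinates. -/
lemma exists_shear_bounds (q : Fin 3 → ℝ) : ∃ (i : Fin 3) (t : Fin 2 → ℝ),
    ∀ (c : ℝ) (p : Fin 3 → ℝ),
      (p - q) i ^ 2 ≤ norm3 (p - q) ^ 2 ∧
      ((p - q) (i.succAbove 0) - t 0 * (p - q) i) ^ 2 ≤ 4 * norm3 (p - q) ^ 2 ∧
      ((p - q) (i.succAbove 1) - t 1 * (p - q) i) ^ 2 ≤ 4 * norm3 (p - q) ^ 2 ∧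
      (c ^ 2 + norm3 q ^ 2) * (((p - q) (i.succAbove 0) - t 0 * (p - q) i) ^ 2 +
        ((p - q) (i.succAbove 1) - t 1 * (p - q) i) ^ 2) ≤
        4 * (norm3 (cross3 p q) ^ 2 + c ^ 2 * norm3 (p - q) ^ 2) := by
  obtain ⟨i, hi⟩ := exists_forall_sq_le q
  refine ⟨i, fun j => q (i.succAbove j) / q i, fun c p => ?_⟩
  have ht (j : Fin 2) : (q (i.succAbove j) / q i) ^ 2 ≤ 1 := by
    rw [div_pow]
    exact div_le_one_of_le₀ (hi _) (sq_nonneg _)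
  have hq (j : Fin 2) : q i * (q (i.succAbove j) / q i) = q (i.succAbove j) := by
    rcases eq_or_ne (q i) 0 with h | h
    · have := hi (i.succAbove j)
      rw [h] at this ⊢
      have : q (i.succAbove j) = 0 := by nlinarith
      simp [this]
    · field_simp
  have hn : norm3 (p - q) ^ 2 =
      (p - q) i ^ 2 + (p - q) (i.succAbove 0) ^ 2 + (p - q) (i.succAbove 1) ^ 2 := by
    rw [norm3_sq]
    fin_cases i <;> simp [Fin.succAbove] <;> ring
  have hnq : norm3 q ^ 2 ≤ 3 * q i ^ 2 := by
    rw [norm3_sq]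
    linarith [hi 0, hi 1, hi 2]
  have hcross : (q i * (p - q) (i.succAbove 0) - q (i.succAbove 0) * (p - q) i) ^ 2 +
      (q i * (p - q) (i.succAbove 1) - q (i.succAbove 1) * (p - q) i) ^ 2 ≤
      norm3 (cross3 p q) ^ 2 := by
    rw [norm3_sq]
    fin_cases i <;> simp [Fin.succAbove, cross3]
    · nlinarith [sq_nonneg (p 1 * q 2 - p 2 * q 1)]
    · nlinarith [sq_nonneg (p 2 * q 0 - p 0 * q 2)]
    · nlinarith [sq_nonneg (p 0 * q 1 - p 1 * q 0)]
  rw [← hq 0, ← hq 1] at hcross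
  have ht0 := ht 0
  have ht1 := ht 1
  rw [hn]
  beta_reduce
  generalize norm3 (cross3 p q) ^ 2 = X at *
  generalize norm3 q ^ 2 = N at *
  generalize q (i.succAbove 0) / q i = t0 at *
  generalize q (i.succAbove 1) / q i = t1 at *
  generalize (p - q) i = x at *
  generalize (p - q) (i.succAbove 0) = y at *
  generalize (p - q) (i.succAbove 1) = z at *
  have hy : (y - t0 * x) ^ 2 ≤ 2 * (x ^ 2 + y ^ 2) := by
    nlinarith [sq_nonneg (y + t0 * x), mul_le_mul_of_nonneg_right ht0 (sq_nonneg x)]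
  have hz : (z - t1 * x) ^ 2 ≤ 2 * (x ^ 2 + z ^ 2) := by
    nlinarith [sq_nonneg (z + t1 * x), mul_le_mul_of_nonneg_right ht1 (sq_nonneg x)]
  have hx2 := sq_nonneg x
  have hy2 := sq_nonneg y
  have hz2 := sq_nonneg z
  refine ⟨by linarith, by linarith, by linarith, ?_⟩
  have h1 : c ^ 2 * ((y - t0 * x) ^ 2 + (z - t1 * x) ^ 2) ≤
      c ^ 2 * (4 * (x ^ 2 + y ^ 2 + z ^ 2)) :=
    mul_le_mul_of_nonneg_left (by linarith) (sq_nonneg c)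
  have h2 : N * ((y - t0 * x) ^ 2 + (z - t1 * x) ^ 2) ≤
      3 * q i ^ 2 * ((y - t0 * x) ^ 2 + (z - t1 * x) ^ 2) :=
    mul_le_mul_of_nonneg_right hnq (by positivity)
  nlinarith [sq_nonneg (q i * (y - t0 * x)), sq_nonneg (q i * (z - t1 * x))]

/-- A polynomial weight is absorbed by half of the exponential decay. -/
lemma exists_weight_le_exp {c γ α : ℝ} (hγ : 0 < γ) (hα : 0 < α) :
    ∃ K > 0, ∀ r, 0 ≤ r → (1 + r ^ 2 / c ^ 2) ^ (α / 2) ≤ K * Real.exp (γ / 2 * r) := by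
  refine ⟨(1 + 2 * α ^ 2 / (γ ^ 2 * c ^ 2)) ^ (α / 2), by positivity, fun r hr => ?_⟩
  have hx : 0 ≤ γ * r / α := by positivity
  have h := Real.quadratic_le_exp_of_nonneg hx
  have h1 : 1 ≤ Real.exp (γ * r / α) := Real.one_le_exp hx
  have h2 : r ^ 2 / c ^ 2 = 2 * α ^ 2 / (γ ^ 2 * c ^ 2) * ((γ * r / α) ^ 2 / 2) := by
    rcases eq_or_ne c 0 with rfl | hc
    · simp
    · field_simp
  have h3 : 1 + r ^ 2 / c ^ 2 ≤
      (1 + 2 * α ^ 2 / (γ ^ 2 * c ^ 2)) * Real.exp (γ * r / α) := by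
    have : 2 * α ^ 2 / (γ ^ 2 * c ^ 2) * ((γ * r / α) ^ 2 / 2) ≤
        2 * α ^ 2 / (γ ^ 2 * c ^ 2) * Real.exp (γ * r / α) :=
      mul_le_mul_of_nonneg_left (by linarith) (by positivity)
    rw [h2]
    linarith
  calc (1 + r ^ 2 / c ^ 2) ^ (α / 2)
      ≤ ((1 + 2 * α ^ 2 / (γ ^ 2 * c ^ 2)) * Real.exp (γ * r / α)) ^ (α / 2) :=
        Real.rpow_le_rpow (by positivity) h3 (by positivity)
    _ = _ := by
        rw [Real.mul_rpow (by positivity) (by positivity), ← Real.exp_mul]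
        congr 2
        field_simp

/-- The integrand is dominated by a product of one-variable singular weights. -/
lemma kbar_mul_weight_le {c γ a b ς η α K : ℝ} (hc : 0 < c) (hγ : 0 < γ)
    (ha : 0 ≤ a) (hb : 0 ≤ b) (hα : 0 < α) (hη : η = 1 - (3 * |ς| + a + 2 * b) / 2)
    (hK : ∀ r, 0 ≤ r → (1 + r ^ 2 / c ^ 2) ^ (α / 2) ≤ K * Real.exp (γ / 2 * r))
    {p q : Fin 3 → ℝ} {x y z : ℝ} (hx : x ≠ 0) (hy : y ≠ 0) (hz : z ≠ 0)
    (hxn : x ^ 2 ≤ norm3 (p - q) ^ 2) (hyn : y ^ 2 ≤ 4 * norm3 (p - q) ^ 2)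
    (hzn : z ^ 2 ≤ 4 * norm3 (p - q) ^ 2)
    (hcross : (c ^ 2 + norm3 q ^ 2) * (y ^ 2 + z ^ 2) ≤
      4 * (norm3 (cross3 p q) ^ 2 + c ^ 2 * norm3 (p - q) ^ 2)) :
    kbar c γ a b ς p q * (c ^ 2 + norm3 p ^ 2) ^ (α / 2) ≤
      2 * 2 ^ ((1 - η) / 2) * 2 ^ (α / 2) * K * (c ^ 2 + norm3 q ^ 2) ^ ((α - η) / 2) *
        ((Real.exp (-(γ / 10) * |x|) * |x| ^ (-(b + |ς|))) *
          ((Real.exp (-(γ / 10) * |y|) * |y| ^ (-(1 / 2 : ℝ))) *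
            (Real.exp (-(γ / 10) * |z|) * |z| ^ (-(1 / 2 : ℝ))))) := by
  have hς := abs_nonneg ς
  have hm : (3 * |ς| + a + 2 * b) / 2 = 1 - η := by linarith
  have hm0 : 0 ≤ 1 - η := by rw [← hm]; positivity
  have hp := norm3_sq_le_two_mul_add p q
  unfold kbar
  rw [hm]
  have hK' := hK _ (norm3_nonneg (p - q))
  have hq0 := norm3_nonneg q
  have hn0 := norm3_nonneg (p - q)
  generalize norm3 (p - q) = n at *
  generalize norm3 q = m at *
  generalize norm3 p = P at *
  generalize norm3 (cross3 p q) = X at *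
  set Q := c ^ 2 + m ^ 2 with hQ
  have hQ0 : 0 < Q := by positivity
  have hx0 := abs_pos.2 hx
  have hy0 := abs_pos.2 hy
  have hz0 := abs_pos.2 hz
  have hxn' : |x| ≤ n := abs_le_of_sq_le_sq hxn hn0
  have hyn' : |y| ≤ 2 * n := abs_le_of_sq_le_sq (by linarith) (by linarith)
  have hzn' : |z| ≤ 2 * n := abs_le_of_sq_le_sq (by linarith) (by linarith)
  have hn : 0 < n := hx0.trans_le hxn'
  have hK0 : 0 ≤ K := by
    have := hK 0 le_rfl
    simp at this
    linarith
  have e1 : (c + m) ^ (1 - η) ≤ 2 ^ ((1 - η) / 2) * Q ^ ((1 - η) / 2) := by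
    rw [← Real.mul_rpow (by positivity) hQ0.le,
      show (c + m) ^ (1 - η) = ((c + m) ^ 2) ^ ((1 - η) / 2) by
        rw [← Real.rpow_natCast, ← Real.rpow_mul (by positivity)]; congr 1; push_cast; ring]
    exact Real.rpow_le_rpow (by positivity) (by nlinarith [sq_nonneg (c - m)]) (by positivity)
  have e2 : (c ^ 2 + P ^ 2) ^ (α / 2) ≤
      2 ^ (α / 2) * Q ^ (α / 2) * (K * Real.exp (γ / 2 * n)) := by
    refine le_trans ?_ (mul_le_mul_of_nonneg_left hK' (by positivity))
    rw [← Real.mul_rpow (by positivity) hQ0.le, ← Real.mul_rpow (by positivity) (by positivity)]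
    refine Real.rpow_le_rpow (by positivity) ?_ (by positivity)
    have : Q * (n ^ 2 / c ^ 2) = n ^ 2 + m ^ 2 * (n ^ 2 / c ^ 2) := by
      rw [hQ]; field_simp
    have h0 : 0 ≤ m ^ 2 * (n ^ 2 / c ^ 2) := by positivity
    nlinarith [sq_nonneg c]
  have e3 : Q ^ (1 / 2 : ℝ) / 2 * (|y| ^ (1 / 2 : ℝ) * |z| ^ (1 / 2 : ℝ)) ≤
      (X ^ 2 + c ^ 2 * n ^ 2) ^ (1 / 2 : ℝ) := by
    have h4 : (2 : ℝ) = 4 ^ (1 / 2 : ℝ) := by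
      rw [← Real.sqrt_eq_rpow, show (4 : ℝ) = 2 ^ 2 by norm_num, Real.sqrt_sq (by norm_num)]
    nth_rewrite 2 [h4]
    rw [← Real.div_rpow (by positivity) (by positivity), ← Real.mul_rpow (by positivity)
      (by positivity), ← Real.mul_rpow (by positivity) (by positivity)]
    refine Real.rpow_le_rpow (by positivity) ?_ (by positivity)
    have : |y| * |z| ≤ y ^ 2 + z ^ 2 := by
      rw [← sq_abs y, ← sq_abs z]
      nlinarith [sq_nonneg (|y| - |z|), mul_pos hy0 hz0]
    nlinarith [mul_le_mul_of_nonneg_left this hQ0.le]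
  have e4 : |x| ^ (b + |ς|) ≤ n ^ (b + |ς|) :=
    Real.rpow_le_rpow hx0.le hxn' (by positivity)
  have e5 : Real.exp (-γ * n) * Real.exp (γ / 2 * n) ≤ Real.exp (-(γ / 10) * |x|) *
      (Real.exp (-(γ / 10) * |y|) * Real.exp (-(γ / 10) * |z|)) := by
    rw [← Real.exp_add, ← Real.exp_add, ← Real.exp_add]
    refine Real.exp_le_exp.2 ?_
    have h := mul_le_mul_of_nonneg_left (show |x| + (|y| + |z|) ≤ 5 * n by linarith) hγ.le
    linarith
  have e6 : Q ^ ((α - η) / 2) = Q ^ ((1 - η) / 2) * Q ^ (α / 2) / Q ^ (1 / 2 : ℝ) := by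
    rw [← Real.rpow_add hQ0, ← Real.rpow_sub hQ0]
    congr 1
    ring
  calc (c + m) ^ (1 - η) * Real.exp (-γ * n) /
        ((X ^ 2 + c ^ 2 * n ^ 2) ^ (1 / 2 : ℝ) * n ^ (b + |ς|)) * (c ^ 2 + P ^ 2) ^ (α / 2)
      ≤ (2 ^ ((1 - η) / 2) * Q ^ ((1 - η) / 2)) * Real.exp (-γ * n) /
        ((Q ^ (1 / 2 : ℝ) / 2 * (|y| ^ (1 / 2 : ℝ) * |z| ^ (1 / 2 : ℝ))) * |x| ^ (b + |ς|)) *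
        (2 ^ (α / 2) * Q ^ (α / 2) * (K * Real.exp (γ / 2 * n))) := by
        gcongr
    _ = 2 * 2 ^ ((1 - η) / 2) * 2 ^ (α / 2) * K * Q ^ ((α - η) / 2) *
        ((Real.exp (-γ * n) * Real.exp (γ / 2 * n)) *
          (|x| ^ (-(b + |ς|)) * (|y| ^ (-(1 / 2 : ℝ)) * |z| ^ (-(1 / 2 : ℝ))))) := by
        rw [e6, Real.rpow_neg hx0.le, Real.rpow_neg hy0.le, Real.rpow_neg hz0.le]
        field_simp
    _ ≤ 2 * 2 ^ ((1 - η) / 2) * 2 ^ (α / 2) * K * Q ^ ((α - η) / 2) *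
        ((Real.exp (-(γ / 10) * |x|) *
          (Real.exp (-(γ / 10) * |y|) * Real.exp (-(γ / 10) * |z|))) *
          (|x| ^ (-(b + |ς|)) * (|y| ^ (-(1 / 2 : ℝ)) * |z| ^ (-(1 / 2 : ℝ))))) := by
        gcongr
    _ = _ := by ring

/-- For every α > 0 one has ∫ k̄(p,q)(c²+|p|²)^{α/2} dp ≤ C(c²+|q|²)^{(α−η)/2}: the
kernel gains a weight p₀^{−η}. -/
theorem kernel_gains_weight (c γ a b ς η : ℝ) (hc : 0 < c) (hγ : 0 < γ)
    (ha : 0 ≤ a) (hb : 0 ≤ b) (hbς : 0 < b + |ς|) (hbς2 : b + |ς| < 1 / 2)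
    (hsum : 3 * |ς| + a + 2 * b < 2) (hη : η = 1 - (3 * |ς| + a + 2 * b) / 2)
    (α : ℝ) (hα : 0 < α) :
    ∃ C > 0, ∀ q : Fin 3 → ℝ,
      ∫⁻ p : Fin 3 → ℝ,
          ENNReal.ofReal (kbar c γ a b ς p q * (c ^ 2 + norm3 p ^ 2) ^ (α / 2)) ≤
        ENNReal.ofReal (C * (c ^ 2 + norm3 q ^ 2) ^ ((α - η) / 2)) := by
  obtain ⟨K, hK0, hK⟩ := exists_weight_le_exp (c := c) hγ hα
  set f := expRpow (γ / 10) (b + |ς|) with hf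
  set g := expRpow (γ / 10) (1 / 2) with hg
  set L := (∫⁻ x, f x) * ((∫⁻ x, g x) * ∫⁻ x, g x) with hL
  have hLtop : L ≠ ⊤ := by
    have h1 := lintegral_expRpow_lt_top (δ := γ / 10) (s := b + |ς|) (by positivity) (by linarith)
    have h2 := lintegral_expRpow_lt_top (δ := γ / 10) (s := 1 / 2) (by positivity) (by norm_num)
    exact (ENNReal.mul_lt_top h1 (ENNReal.mul_lt_top h2 h2)).ne
  set A := 2 * 2 ^ ((1 - η) / 2) * 2 ^ (α / 2) * K with hA
  have hA0 : 0 < A := by positivity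
  refine ⟨A * (L.toReal + 1), by positivity, fun q => ?_⟩
  obtain ⟨i, t, hit⟩ := exists_shear_bounds q
  set B := A * (c ^ 2 + norm3 q ^ 2) ^ ((α - η) / 2) with hB
  have hB0 : 0 < B := by positivity
  have hpt (p : Fin 3 → ℝ) :
      ENNReal.ofReal (kbar c γ a b ς p q * (c ^ 2 + norm3 p ^ 2) ^ (α / 2)) ≤
        ENNReal.ofReal B * (f ((p - q) i) * (g ((p - q) (i.succAbove 0) - t 0 * (p - q) i) *
          g ((p - q) (i.succAbove 1) - t 1 * (p - q) i))) := by
    obtain ⟨h1, h2, h3, h4⟩ := hit c p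
    generalize (p - q) (i.succAbove 0) - t 0 * (p - q) i = y at *
    generalize (p - q) (i.succAbove 1) - t 1 * (p - q) i = z at *
    generalize (p - q) i = x at *
    have hBne : ENNReal.ofReal B ≠ 0 := by simpa using hB0
    have hfx : f x ≠ 0 := expRpow_ne_zero _ _ _
    have hgy : g y ≠ 0 := expRpow_ne_zero _ _ _
    have hgz : g z ≠ 0 := expRpow_ne_zero _ _ _
    by_cases hx : x = 0
    · have : f x = ⊤ := if_pos hx
      rw [this, ENNReal.top_mul (mul_ne_zero hgy hgz), ENNReal.mul_top hBne]
      exact le_top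
    by_cases hy : y = 0
    · have : g y = ⊤ := if_pos hy
      rw [this, ENNReal.top_mul hgz, ENNReal.mul_top hfx, ENNReal.mul_top hBne]
      exact le_top
    by_cases hz : z = 0
    · have : g z = ⊤ := if_pos hz
      rw [this, ENNReal.mul_top hgy, ENNReal.mul_top hfx, ENNReal.mul_top hBne]
      exact le_top
    simp only [hf, hg, expRpow, if_neg hx, if_neg hy, if_neg hz]
    rw [← ENNReal.ofReal_mul (by positivity), ← ENNReal.ofReal_mul (by positivity),
      ← ENNReal.ofReal_mul hB0.le]
    exact ENNReal.ofReal_le_ofReal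
      (kbar_mul_weight_le hc hγ ha hb hα hη hK hx hy hz h1 h2 h3 h4)
  have hfm : Measurable f := measurable_expRpow _ _
  have hgm : Measurable g := measurable_expRpow _ _
  calc ∫⁻ p : Fin 3 → ℝ,
        ENNReal.ofReal (kbar c γ a b ς p q * (c ^ 2 + norm3 p ^ 2) ^ (α / 2))
      ≤ ∫⁻ p : Fin 3 → ℝ, ENNReal.ofReal B * (f ((p - q) i) *
          (g ((p - q) (i.succAbove 0) - t 0 * (p - q) i) *
            g ((p - q) (i.succAbove 1) - t 1 * (p - q) i))) := lintegral_mono hpt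
    _ = ENNReal.ofReal B * L := by
        rw [lintegral_sub_right_eq_self (fun u : Fin 3 → ℝ => ENNReal.ofReal B * (f (u i) *
          (g (u (i.succAbove 0) - t 0 * u i) * g (u (i.succAbove 1) - t 1 * u i)))) q,
          lintegral_const_mul _ (by fun_prop), lintegral_shear hfm hgm]
    _ ≤ ENNReal.ofReal B * ENNReal.ofReal (L.toReal + 1) := by
        gcongr
        exact (ENNReal.le_ofReal_iff_toReal_le hLtop (by positivity)).2 (by linarith)
    _ = ENNReal.ofReal (A * (L.toReal + 1) * (c ^ 2 + norm3 q ^ 2) ^ ((α - η) / 2)) := by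
        rw [← ENNReal.ofReal_mul hB0.le, hB]
        congr 1
        ring
end

section
/- Let 𝔠 > 0, T > 0, z := 𝔠²/T, u ∈ ℝ³, u₀ := √(𝔠²+|u|²), and for p ∈ ℝ³ set p₀ := √(𝔠²+|p|²) and J(p) := (z/(4π𝔠³K₂(z))) · exp(−z(p₀u₀ − p·u)/𝔠²). Then ∫_{ℝ³} p₀ · J(p) dp = (u₀²/𝔠) · (K₃(z)/K₂(z)) − 𝔠/z. -/
open MeasureTheory

/-- The Euclidean inner product on ℝ³. -/
def dot3 (p q : Fin 3 → ℝ) : ℝ := p 0 * q 0 + p 1 * q 1 + p 2 * q 2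

/-- The modified Bessel function K_α(z) = ∫₀^∞ e^{−z cosh t} cosh(αt) dt. -/
noncomputable def Kb (α z : ℝ) : ℝ :=
  ∫ t in Set.Ioi (0 : ℝ), Real.exp (-z * Real.cosh t) * Real.cosh (α * t)

/-- The relativistic Maxwellian (Jüttner distribution) with density 1, bulk velocity u and
temperature T, where z = c²/T:
J(p) = (z/(4πc³K₂(z))) exp(−z(p₀u₀ − p·u)/c²). -/
noncomputable def Jutt (c T : ℝ) (u p : Fin 3 → ℝ) : ℝ :=
  (c ^ 2 / T) / (4 * Real.pi * c ^ 3 * Kb 2 (c ^ 2 / T)) *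
    Real.exp (-(c ^ 2 / T) *
      (Real.sqrt (c ^ 2 + norm3 p ^ 2) * Real.sqrt (c ^ 2 + norm3 u ^ 2) - dot3 p u) /
        c ^ 2)


open Set Filter Topology Real

/-! ### Hyperbolic moments on the half-line -/

/-- The integral of `sinh ^ j * cosh ^ k` against the weight `exp (-z * cosh t)` on `(0, ∞)`. -/
noncomputable def hypMoment (z : ℝ) (j k : ℕ) : ℝ :=
  ∫ t in Ioi (0 : ℝ), sinh t ^ j * cosh t ^ k * exp (-z * cosh t)

lemma tendsto_cosh_atTop : Tendsto cosh atTop atTop := by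
  refine tendsto_atTop_mono (fun x => ?_) (tendsto_exp_atTop.atTop_div_const (two_pos (α := ℝ)))
  rw [cosh_eq]
  linarith [exp_pos (-x)]

lemma tendsto_pow_cosh_mul_exp {z : ℝ} (hz : 0 < z) (n : ℕ) :
    Tendsto (fun t => cosh t ^ n * exp (-z * cosh t)) atTop (𝓝 0) := by
  have h := (tendsto_pow_mul_exp_neg_atTop_nhds_zero n).comp
    (tendsto_cosh_atTop.const_mul_atTop hz)
  have h2 := h.const_mul ((z ^ n)⁻¹)
  rw [mul_zero] at h2
  refine h2.congr fun t => ?_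
  simp only [Function.comp]
  rw [mul_pow, neg_mul]
  field_simp

lemma abs_sinh_le_cosh (t : ℝ) : |sinh t| ≤ cosh t :=
  abs_le_of_sq_le_sq (by nlinarith [cosh_sq t]) (cosh_pos t).le

lemma tendsto_sinh_cosh_mul_exp {z : ℝ} (hz : 0 < z) (j k : ℕ) :
    Tendsto (fun t => sinh t ^ j * cosh t ^ k * exp (-z * cosh t)) atTop (𝓝 0) := by
  refine squeeze_zero_norm (fun t => ?_) (tendsto_pow_cosh_mul_exp hz (j + k))
  rw [norm_mul, norm_mul, norm_pow, norm_pow, Real.norm_eq_abs, Real.norm_eq_abs,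
    Real.norm_eq_abs, abs_exp, abs_of_pos (cosh_pos _), pow_add]
  have := abs_sinh_le_cosh t
  have := (cosh_pos t).le
  gcongr

lemma integrableOn_hypMoment {z : ℝ} (hz : 0 < z) (j k : ℕ) :
    IntegrableOn (fun t => sinh t ^ j * cosh t ^ k * exp (-z * cosh t)) (Ioi 0) := by
  refine integrable_of_isBigO_exp_neg one_pos (by fun_prop) ?_
  have h := (tendsto_sinh_cosh_mul_exp hz j (k + 1)).isBigO_one ℝ
  have h2 : (fun t => (cosh t)⁻¹) =O[atTop] fun t => exp (-1 * t) := by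
    refine Asymptotics.IsBigO.of_bound 2 (Eventually.of_forall fun t => ?_)
    rw [norm_inv, Real.norm_eq_abs, Real.norm_eq_abs, abs_of_pos (cosh_pos _), abs_exp, cosh_eq,
      neg_one_mul, exp_neg]
    have := exp_pos t
    field_simp
    nlinarith
  refine (h.mul h2).congr (fun t => ?_) (fun t => one_mul _)
  have := (cosh_pos t).ne'
  field_simp
  ring

lemma integral_Ioi_of_hasDerivAt_sinh_cosh {z : ℝ} (hz : 0 < z) (j k : ℕ) (hj : j ≠ 0)
    {f' : ℝ → ℝ} (hf' : IntegrableOn f' (Ioi 0))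
    (h : ∀ t, HasDerivAt (fun t => sinh t ^ j * cosh t ^ k * exp (-z * cosh t)) (f' t) t) :
    ∫ t in Ioi (0 : ℝ), f' t = 0 := by
  rw [integral_Ioi_of_hasDerivAt_of_tendsto' (fun t _ => h t) hf'
    (tendsto_sinh_cosh_mul_exp hz j k)]
  simp [hj]

lemma hasDerivAt_exp_neg_mul_cosh (z t : ℝ) :
    HasDerivAt (fun t => exp (-z * cosh t)) (exp (-z * cosh t) * (-z * sinh t)) t :=
  ((hasDerivAt_cosh t).const_mul (-z)).exp

lemma hypMoment_two_zero {z : ℝ} (hz : 0 < z) : z * hypMoment z 2 0 = hypMoment z 0 1 := by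
  have i1 := integrableOn_hypMoment hz 0 1
  have i2 := (integrableOn_hypMoment hz 2 0).const_mul z
  have h := integral_Ioi_of_hasDerivAt_sinh_cosh hz 1 0 one_ne_zero (i1.sub i2) fun t => by
    refine ((((hasDerivAt_sinh t).pow 1).mul ((hasDerivAt_cosh t).pow 0)).mul
      (hasDerivAt_exp_neg_mul_cosh z t)).congr_deriv ?_
    simp
    ring
  simp only [Pi.sub_apply] at h
  rw [integral_sub i1 i2, integral_const_mul] at h
  exact (sub_eq_zero.1 h).symm

lemma hypMoment_two_one {z : ℝ} (hz : 0 < z) :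
    z * hypMoment z 2 1 = hypMoment z 0 2 + hypMoment z 2 0 := by
  have i1 := integrableOn_hypMoment hz 0 2
  have i2 := integrableOn_hypMoment hz 2 0
  have i3 := (integrableOn_hypMoment hz 2 1).const_mul z
  have h := integral_Ioi_of_hasDerivAt_sinh_cosh hz 1 1 one_ne_zero ((i1.fun_add i2).sub i3)
    fun t => by
      refine ((((hasDerivAt_sinh t).pow 1).mul ((hasDerivAt_cosh t).pow 1)).mul
        (hasDerivAt_exp_neg_mul_cosh z t)).congr_deriv ?_
      simp
      ring
  simp only [Pi.sub_apply] at h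
  rw [integral_sub (i1.fun_add i2) i3, integral_add i1 i2, integral_const_mul] at h
  exact (sub_eq_zero.1 h).symm

lemma hypMoment_four_zero {z : ℝ} (hz : 0 < z) :
    z * hypMoment z 4 0 = 3 * hypMoment z 2 1 := by
  have i1 := (integrableOn_hypMoment hz 2 1).const_mul 3
  have i2 := (integrableOn_hypMoment hz 4 0).const_mul z
  have h := integral_Ioi_of_hasDerivAt_sinh_cosh hz 3 0 three_ne_zero (i1.sub i2) fun t => by
    refine ((((hasDerivAt_sinh t).pow 3).mul ((hasDerivAt_cosh t).pow 0)).mul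
      (hasDerivAt_exp_neg_mul_cosh z t)).congr_deriv ?_
    simp
    ring
  simp only [Pi.sub_apply] at h
  rw [integral_sub i1 i2, integral_const_mul, integral_const_mul] at h
  exact (sub_eq_zero.1 h).symm

lemma hypMoment_two_two {z : ℝ} (hz : 0 < z) :
    hypMoment z 2 2 = hypMoment z 4 0 + hypMoment z 2 0 := by
  unfold hypMoment
  rw [← integral_add (integrableOn_hypMoment hz 4 0) (integrableOn_hypMoment hz 2 0)]
  congr 1 with t
  rw [cosh_sq]
  ring

lemma Kb_two_eq {z : ℝ} (hz : 0 < z) : Kb 2 z = z * hypMoment z 2 1 := by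
  rw [hypMoment_two_one hz]
  unfold hypMoment Kb
  rw [← integral_add (integrableOn_hypMoment hz 0 2) (integrableOn_hypMoment hz 2 0)]
  congr 1 with t
  rw [cosh_two_mul]
  ring

lemma Kb_three_eq {z : ℝ} (hz : 0 < z) :
    Kb 3 z = z * hypMoment z 2 0 + 4 * hypMoment z 2 1 := by
  rw [hypMoment_two_zero hz]
  unfold hypMoment Kb
  rw [← integral_const_mul, ← integral_add (integrableOn_hypMoment hz 0 1)
    ((integrableOn_hypMoment hz 2 1).const_mul 4)]
  congr 1 with t
  rw [cosh_three_mul, show cosh t ^ 3 = cosh t * cosh t ^ 2 by ring, cosh_sq]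
  ring

lemma Kb_pos {α z : ℝ} (h : IntegrableOn (fun t => exp (-z * cosh t) * cosh (α * t)) (Ioi 0)) :
    0 < Kb α z := by
  unfold Kb
  rw [setIntegral_pos_iff_support_of_nonneg_ae
    (Eventually.of_forall fun t => (mul_pos (exp_pos _) (cosh_pos (α * t))).le) h]
  rw [Function.support_eq_univ fun t =>
    (mul_pos (exp_pos _) (cosh_pos _)).ne']
  simp

lemma Kb_two_pos {z : ℝ} (hz : 0 < z) : 0 < Kb 2 z := by
  refine Kb_pos (((integrableOn_hypMoment hz 0 2).add (integrableOn_hypMoment hz 2 0)).congr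
    (Eventually.of_forall fun t => ?_))
  simp only [Pi.add_apply]
  rw [cosh_two_mul]
  ring

/-! ### Radial integrals in hyperbolic coordinates -/

lemma image_mul_sinh_Ioi {c : ℝ} (hc : 0 < c) : (fun t => c * sinh t) '' Ioi 0 = Ioi 0 := by
  ext x
  constructor
  · rintro ⟨t, ht, rfl⟩
    exact mul_pos hc (sinh_pos_iff.2 ht)
  · intro hx
    refine ⟨arsinh (x / c), arsinh_pos_iff.2 (div_pos hx hc), ?_⟩
    simp only [sinh_arsinh]
    field_simp

lemma injOn_mul_sinh {c : ℝ} (hc : 0 < c) (s : Set ℝ) : InjOn (fun t => c * sinh t) s :=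
  fun _ _ _ _ h => sinh_injective (mul_left_cancel₀ hc.ne' h)

lemma sqrt_sq_add_mul_sinh_sq {c : ℝ} (hc : 0 < c) (t : ℝ) :
    √(c ^ 2 + (c * sinh t) ^ 2) = c * cosh t := by
  rw [show c ^ 2 + (c * sinh t) ^ 2 = (c * cosh t) ^ 2 by rw [mul_pow, mul_pow, cosh_sq]; ring]
  exact sqrt_sq (mul_pos hc (cosh_pos t)).le

lemma integral_norm_eq_integral_sinh {c : ℝ} (hc : 0 < c) (f : ℝ → ℝ) :
    ∫ p : EuclideanSpace ℝ (Fin 3), f ‖p‖ =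
      4 * π * ∫ t in Ioi (0 : ℝ), c * cosh t * ((c * sinh t) ^ 2 * f (c * sinh t)) := by
  have hv : (volume : Measure (EuclideanSpace ℝ (Fin 3))).real (Metric.ball 0 1) = π * 4 / 3 := by
    rw [Measure.real, EuclideanSpace.volume_ball_fin_three]
    simp [ENNReal.toReal_ofReal (show 0 ≤ π * 4 / 3 by positivity)]
  rw [integral_fun_norm_addHaar, hv, ← image_mul_sinh_Ioi hc,
    integral_image_eq_integral_abs_deriv_smul measurableSet_Ioi
      (fun t _ => ((hasDerivAt_sinh t).const_mul c).hasDerivWithinAt) (injOn_mul_sinh hc _)]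
  simp only [abs_mul, abs_of_pos hc, abs_of_pos (cosh_pos _), finrank_euclideanSpace, Fintype.card_fin,
    smul_eq_mul, nsmul_eq_mul, image_mul_sinh_Ioi hc]
  push_cast
  ring

lemma integrable_norm_iff_integrableOn_sinh {c : ℝ} (hc : 0 < c) (f : ℝ → ℝ) :
    Integrable (fun p : EuclideanSpace ℝ (Fin 3) => f ‖p‖) ↔
      IntegrableOn (fun t => c * cosh t * ((c * sinh t) ^ 2 * f (c * sinh t))) (Ioi 0) := by
  rw [integrable_fun_norm_addHaar, ← image_mul_sinh_Ioi hc,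
    integrableOn_image_iff_integrableOn_abs_deriv_smul measurableSet_Ioi
      (fun t _ => ((hasDerivAt_sinh t).const_mul c).hasDerivWithinAt) (injOn_mul_sinh hc _)]
  simp only [abs_mul, abs_of_pos hc, abs_of_pos (cosh_pos _), finrank_euclideanSpace, Fintype.card_fin,
    smul_eq_mul, image_mul_sinh_Ioi hc]

lemma integrable_energy_mul_exp {b c : ℝ} (hb : 0 < b) (hc : 0 < c) :
    Integrable fun p : EuclideanSpace ℝ (Fin 3) =>
      √(c ^ 2 + ‖p‖ ^ 2) * exp (-b * √(c ^ 2 + ‖p‖ ^ 2)) := by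
  rw [integrable_norm_iff_integrableOn_sinh hc
    (fun r => √(c ^ 2 + r ^ 2) * exp (-b * √(c ^ 2 + r ^ 2)))]
  simp only [sqrt_sq_add_mul_sinh_sq hc]
  refine ((integrableOn_hypMoment (mul_pos hb hc) 2 2).const_mul (c ^ 4)).congr
    (Eventually.of_forall fun t => ?_)
  simp only [neg_mul, mul_assoc]
  ring

lemma integral_energy_mul_exp {b c : ℝ} (hc : 0 < c) :
    ∫ p : EuclideanSpace ℝ (Fin 3), √(c ^ 2 + ‖p‖ ^ 2) * exp (-b * √(c ^ 2 + ‖p‖ ^ 2)) =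
      4 * π * c ^ 4 * hypMoment (b * c) 2 2 := by
  rw [integral_norm_eq_integral_sinh hc
    (fun r => √(c ^ 2 + r ^ 2) * exp (-b * √(c ^ 2 + r ^ 2))), hypMoment, ← integral_const_mul,
    ← integral_const_mul]
  simp only [sqrt_sq_add_mul_sinh_sq hc]
  refine integral_congr_ae (Eventually.of_forall fun t => ?_)
  simp only [neg_mul, mul_assoc]
  ring

lemma integral_norm_sq_div_energy_mul_exp {b c : ℝ} (hc : 0 < c) :
    ∫ p : EuclideanSpace ℝ (Fin 3),
        ‖p‖ ^ 2 * (exp (-b * √(c ^ 2 + ‖p‖ ^ 2)) / √(c ^ 2 + ‖p‖ ^ 2)) =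
      4 * π * c ^ 4 * hypMoment (b * c) 4 0 := by
  rw [integral_norm_eq_integral_sinh hc
    (fun r => r ^ 2 * (exp (-b * √(c ^ 2 + r ^ 2)) / √(c ^ 2 + r ^ 2))), hypMoment,
    ← integral_const_mul, ← integral_const_mul]
  simp only [sqrt_sq_add_mul_sinh_sq hc]
  refine integral_congr_ae (Eventually.of_forall fun t => ?_)
  have := (cosh_pos t).ne'
  simp only [neg_mul, mul_assoc]
  field_simp

/-! ### Rotation invariance -/

lemma integral_inner_norm_congr {F : Type*} [NormedAddCommGroup F] [InnerProductSpace ℝ F]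
    [FiniteDimensional ℝ F] [MeasurableSpace F] [BorelSpace F] {v w : F} (h : ‖v‖ = ‖w‖)
    (f : ℝ → ℝ → ℝ) : ∫ p : F, f (inner ℝ p v) ‖p‖ = ∫ p : F, f (inner ℝ p w) ‖p‖ := by
  let R := (Submodule.span ℝ {v - w})ᗮ.reflection
  have hR : R v = w := Submodule.reflection_sub h
  rw [← R.measurePreserving.integral_comp R.toHomeomorph.measurableEmbedding
    (fun p => f (inner ℝ p w) ‖p‖)]
  simp only [← hR, LinearIsometryEquiv.inner_map_map, LinearIsometryEquiv.norm_map]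

lemma integral_coord_sq_mul_norm (i : Fin 3) (g : ℝ → ℝ)
    (hg : ∀ i, Integrable fun p : EuclideanSpace ℝ (Fin 3) => p i ^ 2 * g ‖p‖) :
    ∫ p : EuclideanSpace ℝ (Fin 3), p i ^ 2 * g ‖p‖ =
      (∫ p : EuclideanSpace ℝ (Fin 3), ‖p‖ ^ 2 * g ‖p‖) / 3 := by
  have h (j : Fin 3) : ∫ p : EuclideanSpace ℝ (Fin 3), p j ^ 2 * g ‖p‖ =
      ∫ p : EuclideanSpace ℝ (Fin 3), p i ^ 2 * g ‖p‖ := by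
    have := integral_inner_norm_congr (v := EuclideanSpace.single j (1 : ℝ))
      (w := EuclideanSpace.single i (1 : ℝ)) (by simp) (fun x r => x ^ 2 * g r)
    simpa [EuclideanSpace.inner_single_right] using this
  have hs : ∫ p : EuclideanSpace ℝ (Fin 3), ‖p‖ ^ 2 * g ‖p‖ =
      ∑ j, ∫ p : EuclideanSpace ℝ (Fin 3), p j ^ 2 * g ‖p‖ := by
    rw [← integral_finsetSum _ fun j _ => hg j]
    congr 1 with p
    rw [EuclideanSpace.real_norm_sq_eq, Finset.sum_mul]
  rw [hs, Finset.sum_congr rfl fun j _ => h j]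
  simp

/-! ### The Lorentz boost along the first axis -/

section Boost

variable {C S : ℝ}

lemma boost_pos (hC : 0 < C) (hCS : C ^ 2 = S ^ 2 + 1) {m : ℝ} (hm : 0 < m) (x : ℝ) :
    0 < C * √(m + x ^ 2) + S * x := by
  have hq := sq_sqrt (show 0 ≤ m + x ^ 2 by positivity)
  have : |S * x| < C * √(m + x ^ 2) := by
    refine abs_lt_of_sq_lt_sq ?_ (by positivity)
    rw [mul_pow, mul_pow, hq]
    nlinarith [sq_nonneg S, sq_nonneg x, mul_nonneg (sq_nonneg S) hm.le]
  linarith [neg_abs_le (S * x)]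

lemma sqrt_add_boost_sq (hC : 0 < C) (hCS : C ^ 2 = S ^ 2 + 1) {m : ℝ} (hm : 0 < m) (x : ℝ) :
    √(m + (C * x + S * √(m + x ^ 2)) ^ 2) = C * √(m + x ^ 2) + S * x := by
  have hq := sq_sqrt (show 0 ≤ m + x ^ 2 by positivity)
  rw [show m + (C * x + S * √(m + x ^ 2)) ^ 2 = (C * √(m + x ^ 2) + S * x) ^ 2 by
    linear_combination (-C ^ 2 + S ^ 2) * hq - m * hCS]
  exact sqrt_sq (boost_pos hC hCS hm x).le

lemma neg_boost_boost (hC : 0 < C) (hCS : C ^ 2 = S ^ 2 + 1) {m : ℝ} (hm : 0 < m) (x : ℝ) :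
    C * (C * x + S * √(m + x ^ 2)) - S * √(m + (C * x + S * √(m + x ^ 2)) ^ 2) = x := by
  rw [sqrt_add_boost_sq hC hCS hm]
  linear_combination x * hCS

lemma hasDerivAt_boost {m : ℝ} (hm : 0 < m) (x : ℝ) :
    HasDerivAt (fun x => C * x + S * √(m + x ^ 2))
      ((C * √(m + x ^ 2) + S * x) / √(m + x ^ 2)) x := by
  have h0 : 0 < m + x ^ 2 := by positivity
  refine (((hasDerivAt_id x).const_mul C).add
    ((((hasDerivAt_pow 2 x).const_add m).sqrt h0.ne').const_mul S)).congr_deriv ?_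
  have := (sqrt_pos.2 h0).ne'
  field_simp
  ring

lemma integral_boost (hC : 0 < C) (hCS : C ^ 2 = S ^ 2 + 1) {m : ℝ} (hm : 0 < m) (b : ℝ) :
    ∫ x : ℝ, √(m + x ^ 2) * exp (-b * (C * √(m + x ^ 2) - S * x)) =
      ∫ x : ℝ, (C * √(m + x ^ 2) + S * x) ^ 2 / √(m + x ^ 2) * exp (-b * √(m + x ^ 2)) := by
  have himg : (fun x => C * x + S * √(m + x ^ 2)) '' univ = univ := by
    rw [image_univ, range_eq_univ]
    intro y
    refine ⟨C * y + -S * √(m + y ^ 2), ?_⟩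
    have := neg_boost_boost (S := -S) hC (by linarith) hm y
    simpa using this
  have hinj : InjOn (fun x => C * x + S * √(m + x ^ 2)) univ := by
    intro x _ y _ h
    simp only at h
    rw [← neg_boost_boost hC hCS hm x, h, neg_boost_boost hC hCS hm y]
  have h := integral_image_eq_integral_abs_deriv_smul MeasurableSet.univ
    (fun x _ => (hasDerivAt_boost hm x).hasDerivWithinAt) hinj
    (fun x => √(m + x ^ 2) * exp (-b * (C * √(m + x ^ 2) - S * x)))
  rw [himg, Measure.restrict_univ] at h
  rw [h]
  congr 1 with x
  have hq : 0 < √(m + x ^ 2) := sqrt_pos.2 (by positivity)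
  rw [sqrt_add_boost_sq hC hCS hm, abs_of_pos (div_pos (boost_pos hC hCS hm x) hq), smul_eq_mul,
    show C * (C * √(m + x ^ 2) + S * x) - S * (C * x + S * √(m + x ^ 2)) = √(m + x ^ 2) by
      linear_combination √(m + x ^ 2) * hCS]
  ring

end Boost

lemma integral_euclideanSpace_eq_iterated (f : EuclideanSpace ℝ (Fin 3) → ℝ)
    (hf : Integrable f) :
    ∫ p, f p = ∫ y : Fin 2 → ℝ, ∫ x : ℝ, f (WithLp.toLp 2 (Fin.cons x y)) := by
  let e := MeasurableEquiv.piFinSuccAbove (fun _ : Fin 3 => ℝ) 0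
  have he : MeasurePreserving e.symm := (volume_preserving_piFinSuccAbove (fun _ => ℝ) 0).symm e
  have ht : MeasurePreserving (MeasurableEquiv.toLp 2 (Fin 3 → ℝ)) :=
    PiLp.volume_preserving_toLp (Fin 3)
  have hi : Integrable fun z : ℝ × (Fin 2 → ℝ) => f (WithLp.toLp 2 (e.symm z)) :=
    (he.integrable_comp_emb e.symm.measurableEmbedding).2
      ((ht.integrable_comp_emb (MeasurableEquiv.measurableEmbedding _)).2 hf)
  rw [← ht.integral_comp', ← he.integral_comp']
  refine (integral_prod_symm _ hi).trans ?_
  simp [e, MeasurableEquiv.piFinSuccAbove_symm_apply, Fin.insertNthEquiv]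

lemma abs_coord_le_energy (c : ℝ) (p : EuclideanSpace ℝ (Fin 3)) (i : Fin 3) :
    |p i| ≤ √(c ^ 2 + ‖p‖ ^ 2) :=
  (PiLp.norm_apply_le p i).trans (le_sqrt_of_sq_le (by nlinarith [sq_nonneg c]))

section Moments

variable {b c : ℝ}

lemma integrable_coord_sq_div_energy (hb : 0 < b) (hc : 0 < c) (i : Fin 3) :
    Integrable fun p : EuclideanSpace ℝ (Fin 3) =>
      p i ^ 2 * (exp (-b * √(c ^ 2 + ‖p‖ ^ 2)) / √(c ^ 2 + ‖p‖ ^ 2)) := by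
  refine (integrable_energy_mul_exp hb hc).mono' (by fun_prop) (Eventually.of_forall fun p => ?_)
  have hq : 0 < √(c ^ 2 + ‖p‖ ^ 2) := sqrt_pos.2 (by positivity)
  have hp := abs_coord_le_energy c p i
  rw [Real.norm_of_nonneg (by positivity), ← sq_abs, mul_div_assoc', div_le_iff₀ hq,
    mul_right_comm, ← sq]
  gcongr

lemma integrable_coord_mul_exp (hb : 0 < b) (hc : 0 < c) (i : Fin 3) :
    Integrable fun p : EuclideanSpace ℝ (Fin 3) => p i * exp (-b * √(c ^ 2 + ‖p‖ ^ 2)) := by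
  refine (integrable_energy_mul_exp hb hc).mono' (by fun_prop) (Eventually.of_forall fun p => ?_)
  rw [norm_mul, Real.norm_eq_abs, Real.norm_eq_abs, abs_exp]
  have hp := abs_coord_le_energy c p i
  gcongr

lemma integral_coord_mul_exp (i : Fin 3) :
    ∫ p : EuclideanSpace ℝ (Fin 3), p i * exp (-b * √(c ^ 2 + ‖p‖ ^ 2)) = 0 := by
  have h := integral_neg_eq_self
    (fun p : EuclideanSpace ℝ (Fin 3) => p i * exp (-b * √(c ^ 2 + ‖p‖ ^ 2))) volume
  simp only [norm_neg, PiLp.neg_apply, neg_mul (_ : ℝ) (exp _), integral_neg] at h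
  linarith

lemma integrable_boosted_energy {C S : ℝ} (hC : 0 < C) (hCS : C ^ 2 = S ^ 2 + 1) (hb : 0 < b)
    (hc : 0 < c) :
    Integrable fun p : EuclideanSpace ℝ (Fin 3) =>
      √(c ^ 2 + ‖p‖ ^ 2) * exp (-b * (C * √(c ^ 2 + ‖p‖ ^ 2) - S * p 0)) := by
  have hSC : |S| < C := abs_lt_of_sq_lt_sq (by linarith) hC.le
  refine (integrable_energy_mul_exp (mul_pos hb (sub_pos.2 hSC)) hc).mono' (by fun_prop)
    (Eventually.of_forall fun p => ?_)
  rw [Real.norm_of_nonneg (by positivity)]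
  have h : S * p 0 ≤ |S| * √(c ^ 2 + ‖p‖ ^ 2) := by
    refine (le_abs_self _).trans ?_
    rw [abs_mul]
    have := abs_coord_le_energy c p 0
    gcongr
  refine mul_le_mul_of_nonneg_left (exp_le_exp.2 ?_) (sqrt_nonneg _)
  nlinarith [mul_le_mul_of_nonneg_left h hb.le]

lemma integral_boosted_energy {C S : ℝ} (hC : 0 < C) (hCS : C ^ 2 = S ^ 2 + 1) (hb : 0 < b)
    (hc : 0 < c) :
    ∫ p : EuclideanSpace ℝ (Fin 3),
        √(c ^ 2 + ‖p‖ ^ 2) * exp (-b * (C * √(c ^ 2 + ‖p‖ ^ 2) - S * p 0)) =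
      4 * π * c ^ 4 * (C ^ 2 * hypMoment (b * c) 2 2 + S ^ 2 * (hypMoment (b * c) 4 0 / 3)) := by
  have i1 := (integrable_energy_mul_exp hb hc).const_mul (C ^ 2)
  have i2 := (integrable_coord_mul_exp hb hc 0).const_mul (2 * C * S)
  have i3 := (integrable_coord_sq_div_energy hb hc 0).const_mul (S ^ 2)
  have hsplit (p : EuclideanSpace ℝ (Fin 3)) :
      (C * √(c ^ 2 + ‖p‖ ^ 2) + S * p 0) ^ 2 / √(c ^ 2 + ‖p‖ ^ 2) *
          exp (-b * √(c ^ 2 + ‖p‖ ^ 2)) =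
        C ^ 2 * (√(c ^ 2 + ‖p‖ ^ 2) * exp (-b * √(c ^ 2 + ‖p‖ ^ 2))) +
          2 * C * S * (p 0 * exp (-b * √(c ^ 2 + ‖p‖ ^ 2))) +
          S ^ 2 * (p 0 ^ 2 * (exp (-b * √(c ^ 2 + ‖p‖ ^ 2)) / √(c ^ 2 + ‖p‖ ^ 2))) := by
    have hq : √(c ^ 2 + ‖p‖ ^ 2) ≠ 0 := (sqrt_pos.2 (by positivity)).ne'
    field_simp
    ring
  have hboosted : Integrable fun p : EuclideanSpace ℝ (Fin 3) =>
      (C * √(c ^ 2 + ‖p‖ ^ 2) + S * p 0) ^ 2 / √(c ^ 2 + ‖p‖ ^ 2) *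
        exp (-b * √(c ^ 2 + ‖p‖ ^ 2)) :=
    ((i1.add i2).add i3).congr (Eventually.of_forall fun p => (hsplit p).symm)
  have hboost : ∫ p : EuclideanSpace ℝ (Fin 3),
        √(c ^ 2 + ‖p‖ ^ 2) * exp (-b * (C * √(c ^ 2 + ‖p‖ ^ 2) - S * p 0)) =
      ∫ p : EuclideanSpace ℝ (Fin 3),
        (C * √(c ^ 2 + ‖p‖ ^ 2) + S * p 0) ^ 2 / √(c ^ 2 + ‖p‖ ^ 2) *
          exp (-b * √(c ^ 2 + ‖p‖ ^ 2)) := by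
    rw [integral_euclideanSpace_eq_iterated _ (integrable_boosted_energy hC hCS hb hc),
      integral_euclideanSpace_eq_iterated _ hboosted]
    congr 1 with y
    have hn (x : ℝ) : c ^ 2 + ‖WithLp.toLp 2 (Fin.cons x y : Fin 3 → ℝ)‖ ^ 2 =
        c ^ 2 + (y 0 ^ 2 + y 1 ^ 2) + x ^ 2 := by
      rw [EuclideanSpace.real_norm_sq_eq, Fin.sum_univ_succ, Fin.sum_univ_two]
      simp only [Fin.cons_zero, Fin.cons_succ]
      ring
    simp only [hn, Fin.cons_zero]
    exact integral_boost hC hCS (by positivity) b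
  rw [hboost]
  simp only [hsplit]
  rw [integral_add (i1.fun_add i2) i3, integral_add i1 i2, integral_const_mul, integral_const_mul,
    integral_const_mul, integral_energy_mul_exp hc, integral_coord_mul_exp,
    integral_coord_sq_mul_norm 0 (fun r => exp (-b * √(c ^ 2 + r ^ 2)) / √(c ^ 2 + r ^ 2))
      (integrable_coord_sq_div_energy hb hc), integral_norm_sq_div_energy_mul_exp hc]
  ring

end Moments

lemma norm3_eq_norm (p : Fin 3 → ℝ) : norm3 p = ‖WithLp.toLp 2 p‖ := by
  rw [norm3, EuclideanSpace.norm_eq, Fin.sum_univ_three]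
  simp

lemma dot3_eq_inner (p q : Fin 3 → ℝ) :
    dot3 p q = inner ℝ (WithLp.toLp 2 p) (WithLp.toLp 2 q) := by
  simp [dot3, PiLp.inner_apply, Fin.sum_univ_three, mul_comm]

/-- The energy moment of the Jüttner distribution:
∫ p₀ J dp = (u₀²/c)(K₃(z)/K₂(z)) − c/z with z = c²/T. -/
theorem juttner_energy_moment (c T : ℝ) (hc : 0 < c) (hT : 0 < T) (u : Fin 3 → ℝ) :
    (∫ p : Fin 3 → ℝ, Real.sqrt (c ^ 2 + norm3 p ^ 2) * Jutt c T u p) =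
      (Real.sqrt (c ^ 2 + norm3 u ^ 2) ^ 2 / c) * (Kb 3 (c ^ 2 / T) / Kb 2 (c ^ 2 / T)) -
        c / (c ^ 2 / T) := by
  have hz : 0 < c ^ 2 / T := by positivity
  obtain ⟨z, hzdef⟩ : ∃ z, z = c ^ 2 / T := ⟨_, rfl⟩
  simp only [Jutt, norm3_eq_norm, dot3_eq_inner, ← hzdef] at hz ⊢
  have ht : MeasurePreserving (MeasurableEquiv.toLp 2 (Fin 3 → ℝ)) :=
    PiLp.volume_preserving_toLp (Fin 3)
  set v := WithLp.toLp 2 u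
  have hu0 : 0 < √(c ^ 2 + ‖v‖ ^ 2) := sqrt_pos.2 (by positivity)
  have hu0sq : √(c ^ 2 + ‖v‖ ^ 2) ^ 2 = c ^ 2 + ‖v‖ ^ 2 := sq_sqrt (by positivity)
  set u₀ := √(c ^ 2 + ‖v‖ ^ 2)
  have hCS : (u₀ / c) ^ 2 = (‖v‖ / c) ^ 2 + 1 := by
    rw [div_pow, div_pow, hu0sq]
    field_simp
    ring
  have hrot := integral_inner_norm_congr (v := v) (w := EuclideanSpace.single 0 ‖v‖) (by simp)
    (fun x r => √(c ^ 2 + r ^ 2) * (z / (4 * π * c ^ 3 * Kb 2 z) *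
      exp (-z * (√(c ^ 2 + r ^ 2) * u₀ - x) / c ^ 2)))
  have hmain := integral_boosted_energy (div_pos hu0 hc) hCS (div_pos hz hc) hc
  have hscale (p : EuclideanSpace ℝ (Fin 3)) :
      √(c ^ 2 + ‖p‖ ^ 2) * (z / (4 * π * c ^ 3 * Kb 2 z) *
        exp (-z * (√(c ^ 2 + ‖p‖ ^ 2) * u₀ - inner ℝ p (EuclideanSpace.single 0 ‖v‖)) / c ^ 2)) =
      z / (4 * π * c ^ 3 * Kb 2 z) * (√(c ^ 2 + ‖p‖ ^ 2) *
        exp (-(z / c) * (u₀ / c * √(c ^ 2 + ‖p‖ ^ 2) - ‖v‖ / c * p 0))) := by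
    rw [mul_left_comm]
    congr 3
    simp only [EuclideanSpace.inner_single_right, conj_trivial]
    field_simp
  calc _ = ∫ p : EuclideanSpace ℝ (Fin 3), √(c ^ 2 + ‖p‖ ^ 2) *
        (z / (4 * π * c ^ 3 * Kb 2 z) *
          exp (-z * (√(c ^ 2 + ‖p‖ ^ 2) * u₀ - inner ℝ p v) / c ^ 2)) :=
        ht.integral_comp' (fun p : EuclideanSpace ℝ (Fin 3) => √(c ^ 2 + ‖p‖ ^ 2) *
          (z / (4 * π * c ^ 3 * Kb 2 z) *
            exp (-z * (√(c ^ 2 + ‖p‖ ^ 2) * u₀ - inner ℝ p v) / c ^ 2)))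
    _ = _ := by
      rw [hrot]
      simp only [hscale]
      rw [integral_const_mul, hmain, div_mul_cancel₀ z hc.ne', Kb_three_eq hz]
      have hK := (Kb_two_pos hz).ne'
      have hB := Kb_two_eq hz
      have hD : hypMoment z 4 0 = 3 * hypMoment z 2 1 / z := by
        rw [eq_div_iff hz.ne', mul_comm, hypMoment_four_zero hz]
      have hv : ‖v‖ ^ 2 = u₀ ^ 2 - c ^ 2 := by rw [hu0sq]; ring
      rw [hypMoment_two_two hz, hD, div_pow, div_pow, hv, hB]
      have hB0 : hypMoment z 2 1 ≠ 0 := fun h => hK (by rw [hB, h, mul_zero])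
      have := pi_pos.ne'
      field_simp
      ring
end
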